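/- Corollary 1 (explicit form). Suppose the association g satisfies Σ_{λ=1}^{Λ} ( σ_λ² + (μ_λ − K_p/Λ)² ) ≤ (K_p/Λ)². Then T̄(g) ≤ 2 · (K_p/Λ) · (Λ−t)/(1+t), and consequently T̄(g) ≤ 2 · T̄(g′) for every user-to-cache association g′; i.e., g is within a factor 2 of the optimal association. -/

import Mathlib

open Finset

noncomputable section

/-- Probability weight of an activity pattern `ω` under independent Bernoulli
activities with success probabilities `p`. -/
def wgt {K : ℕ} (p : Fin K → ℝ) (ω : Fin K → Bool) : ℝ :=
  ∏ k, if ω k then p k else 1 - p k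

/-- Load of cache `c` under association `g` and activity pattern `ω`:
the number of active users assigned to cache `c`. -/
def load {K Λ : ℕ} (g : Fin K → Fin Λ) (ω : Fin K → Bool) (c : Fin Λ) : ℕ :=
  ∑ k, if g k = c ∧ ω k = true then 1 else 0

/-- Decreasing rearrangement of a tuple of naturals, indexed by `ℕ`
(value `0` out of range): `sortDescN v 0` is the largest entry,
`sortDescN v (Λ-1)` the smallest. -/
def sortDescN {Λ : ℕ} (v : Fin Λ → ℕ) (i : ℕ) : ℕ :=
  if h : i < Λ then (v ∘ Tuple.sort v) (Fin.rev ⟨i, h⟩) else 0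

/-- Expectation of a real-valued functional of the activity pattern. -/
def expec {K : ℕ} (p : Fin K → ℝ) (f : (Fin K → Bool) → ℝ) : ℝ :=
  ∑ ω : Fin K → Bool, wgt p ω * f ω

/-- Average worst-case delay of association `g`:
`T̄(g) = ∑_{λ=1}^{Λ-t} E[l_λ] C(Λ-λ,t)/C(Λ,t)` (here `i = λ - 1` is 0-based). -/
def avgDelay {K Λ : ℕ} (p : Fin K → ℝ) (g : Fin K → Fin Λ) (t : ℕ) : ℝ :=
  ∑ i ∈ Finset.range (Λ - t),
    expec p (fun ω => (sortDescN (load g ω) i : ℝ)) * ((Λ - 1 - i).choose t : ℝ) /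
      (Λ.choose t : ℝ)

/-- `μ_λ`: expected number of active users assigned to cache `c`. -/
def muC {K Λ : ℕ} (p : Fin K → ℝ) (g : Fin K → Fin Λ) (c : Fin Λ) : ℝ :=
  ∑ k, if g k = c then p k else 0

/-- `σ_λ²`: variance of the number of active users assigned to cache `c`. -/
def sigma2C {K Λ : ℕ} (p : Fin K → ℝ) (g : Fin K → Fin Λ) (c : Fin Λ) : ℝ :=
  ∑ k, if g k = c then p k * (1 - p k) else 0

/-- `|G_λ|`: the number of users assigned to cache `c`. -/
def Gcard {K Λ : ℕ} (g : Fin K → Fin Λ) (c : Fin Λ) : ℕ :=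
  (Finset.univ.filter fun k => g k = c).card

/-- Binomial cumulative distribution function `F_bin(n,q,x)`. -/
def Fbin (n : ℕ) (q : ℝ) (x : ℕ) : ℝ :=
  ∑ i ∈ Finset.range (x + 1), (n.choose i : ℝ) * q ^ i * (1 - q) ^ (n - i)

section

variable {K Λ : ℕ}

theorem wgt_nonneg {p : Fin K → ℝ} (hp : ∀ k, 0 ≤ p k ∧ p k ≤ 1) (ω : Fin K → Bool) :
    0 ≤ wgt p ω := by
  refine Finset.prod_nonneg fun k _ => ?_
  split_ifs
  · exact (hp k).1
  · linarith [(hp k).2]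

/-- Expectation of a product of functions of distinct coordinates. -/
theorem expec_prod (p : Fin K → ℝ) (f : Fin K → Bool → ℝ) :
    expec p (fun ω => ∏ k, f k (ω k)) = ∏ k, (p k * f k true + (1 - p k) * f k false) := by
  have h := Finset.prod_univ_sum (fun _ : Fin K => (Finset.univ : Finset Bool))
    (fun k b => (if b then p k else 1 - p k) * f k b)
  simp only [Fintype.piFinset_univ] at h
  simp only [expec, wgt, ← Finset.prod_mul_distrib]
  rw [← h]
  exact Finset.prod_congr rfl fun k _ => by simp

theorem expec_one (p : Fin K → ℝ) : expec p (fun _ => 1) = 1 := by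
  simpa using expec_prod p (fun _ _ => 1)

theorem expec_const (p : Fin K → ℝ) (a : ℝ) : expec p (fun _ => a) = a := by
  have h := expec_one p
  simp only [expec, mul_one] at h
  simp [expec, ← Finset.sum_mul, h]

theorem expec_add (p : Fin K → ℝ) (f h : (Fin K → Bool) → ℝ) :
    expec p (fun ω => f ω + h ω) = expec p f + expec p h := by
  simp [expec, mul_add, Finset.sum_add_distrib]

theorem expec_mul_left (p : Fin K → ℝ) (a : ℝ) (f : (Fin K → Bool) → ℝ) :
    expec p (fun ω => a * f ω) = a * expec p f := by
  simp only [expec, Finset.mul_sum]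
  exact Finset.sum_congr rfl fun _ _ => by ring

theorem expec_sum {ι : Type*} (s : Finset ι) (p : Fin K → ℝ) (f : ι → (Fin K → Bool) → ℝ) :
    expec p (fun ω => ∑ i ∈ s, f i ω) = ∑ i ∈ s, expec p (f i) := by
  simp only [expec, Finset.mul_sum]
  exact Finset.sum_comm

theorem expec_mono {p : Fin K → ℝ} (hp : ∀ k, 0 ≤ p k ∧ p k ≤ 1) {f h : (Fin K → Bool) → ℝ}
    (hfh : ∀ ω, f ω ≤ h ω) : expec p f ≤ expec p h :=
  Finset.sum_le_sum fun ω _ => mul_le_mul_of_nonneg_left (hfh ω) (wgt_nonneg hp ω)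

theorem sq_expec_sub_le {p : Fin K → ℝ} (hp : ∀ k, 0 ≤ p k ∧ p k ≤ 1)
    (f : (Fin K → Bool) → ℝ) (m : ℝ) :
    (expec p f - m) ^ 2 ≤ expec p (fun ω => (f ω - m) ^ 2) := by
  set e := expec p f
  have hle : expec p (fun ω => (2 * (e - m)) * f ω + (m ^ 2 - e ^ 2)) ≤
      expec p (fun ω => (f ω - m) ^ 2) :=
    expec_mono hp fun ω => by nlinarith [sq_nonneg (f ω - e)]
  rw [expec_add, expec_mul_left, expec_const] at hle
  linarith

/-- Expectation of a function of a single coordinate. -/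
theorem expec_apply (p : Fin K → ℝ) (j : Fin K) (f : Bool → ℝ) :
    expec p (fun ω => f (ω j)) = p j * f true + (1 - p j) * f false := by
  have h := expec_prod p (fun i b => if i = j then f b else 1)
  simp only [Finset.prod_ite_eq', Finset.mem_univ, if_true] at h
  rw [h, Finset.prod_eq_single j]
  · simp
  · intro i _ hi
    simp [hi]
  · simp

/-- Distinct coordinates are independent. -/
theorem expec_mul_apply (p : Fin K → ℝ) {j k : Fin K} (hjk : j ≠ k) (f h : Bool → ℝ) :
    expec p (fun ω => f (ω j) * h (ω k)) =
      (p j * f true + (1 - p j) * f false) * (p k * h true + (1 - p k) * h false) := by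
  have e := expec_prod p (fun i b => (if i = j then f b else 1) * (if i = k then h b else 1))
  simp only [Finset.prod_mul_distrib, Finset.prod_ite_eq', Finset.mem_univ, if_true] at e
  rw [e, Finset.prod_eq_mul j k hjk]
  · simp [hjk, hjk.symm]
  · intro i _ hi
    simp [hi.1, hi.2]
  · simp
  · simp

/-- The centred contribution of user `k` to the load of cache `c`. -/
def centred (p : Fin K → ℝ) (g : Fin K → Fin Λ) (c : Fin Λ) (k : Fin K) (b : Bool) : ℝ :=
  if g k = c then (if b then 1 else 0) - p k else 0

theorem load_eq_muC_add (p : Fin K → ℝ) (g : Fin K → Fin Λ) (c : Fin Λ) (ω : Fin K → Bool) :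
    (load g ω c : ℝ) = muC p g c + ∑ k, centred p g c k (ω k) := by
  simp only [load, muC, centred, ← Finset.sum_add_distrib]
  push_cast
  refine Finset.sum_congr rfl fun k _ => ?_
  by_cases h : g k = c <;> simp [h]

theorem centred_mean (p : Fin K → ℝ) (g : Fin K → Fin Λ) (c : Fin Λ) (k : Fin K) :
    p k * centred p g c k true + (1 - p k) * centred p g c k false = 0 := by
  by_cases h : g k = c
  · simp only [centred, h, if_true]
    norm_num
    ring
  · simp [centred, h]

theorem expec_sum_centred (p : Fin K → ℝ) (g : Fin K → Fin Λ) (c : Fin Λ) :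
    expec p (fun ω => ∑ k, centred p g c k (ω k)) = 0 := by
  rw [expec_sum]
  exact Finset.sum_eq_zero fun k _ => by rw [expec_apply, centred_mean]

theorem expec_sum_centred_sq (p : Fin K → ℝ) (g : Fin K → Fin Λ) (c : Fin Λ) :
    expec p (fun ω => (∑ k, centred p g c k (ω k)) ^ 2) = sigma2C p g c := by
  simp only [sq, Finset.sum_mul_sum]
  rw [expec_sum, sigma2C]
  refine Finset.sum_congr rfl fun k _ => ?_
  rw [expec_sum, Finset.sum_eq_single k]
  · rw [expec_apply p k (fun b => centred p g c k b * centred p g c k b)]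
    by_cases h : g k = c
    · simp only [centred, h, if_true]
      norm_num
      ring
    · simp [centred, h]
  · intro j _ hj
    rw [expec_mul_apply p hj.symm, centred_mean, zero_mul]
  · simp

theorem expec_load (p : Fin K → ℝ) (g : Fin K → Fin Λ) (c : Fin Λ) :
    expec p (fun ω => (load g ω c : ℝ)) = muC p g c := by
  simp only [load_eq_muC_add p]
  rw [expec_add, expec_const, expec_sum_centred, add_zero]

theorem expec_load_sub_sq (p : Fin K → ℝ) (g : Fin K → Fin Λ) (c : Fin Λ) (m : ℝ) :
    expec p (fun ω => ((load g ω c : ℝ) - m) ^ 2) = sigma2C p g c + (muC p g c - m) ^ 2 := by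
  have h : (fun ω => ((load g ω c : ℝ) - m) ^ 2) = fun ω =>
      (∑ k, centred p g c k (ω k)) ^ 2 + ((2 * (muC p g c - m)) * ∑ k, centred p g c k (ω k) +
        (muC p g c - m) ^ 2) := by
    funext ω
    rw [load_eq_muC_add p]
    ring
  rw [h, expec_add, expec_add, expec_mul_left, expec_const, expec_sum_centred,
    expec_sum_centred_sq]
  ring

theorem sum_muC (p : Fin K → ℝ) (g : Fin K → Fin Λ) : ∑ c, muC p g c = ∑ k, p k := by
  simp only [muC]
  rw [Finset.sum_comm]
  simp

theorem sum_sortDescN (v : Fin Λ → ℕ) (F : ℕ → ℝ) :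
    ∑ i ∈ Finset.range Λ, F (sortDescN v i) = ∑ c, F (v c) := by
  rw [← Fin.sum_univ_eq_sum_range (fun i => F (sortDescN v i)),
    ← Equiv.sum_comp (Fin.revPerm.trans (Tuple.sort v)) (fun c => F (v c))]
  exact Finset.sum_congr rfl fun i _ => by simp [sortDescN]

theorem sortDescN_antitoneOn (v : Fin Λ → ℕ) :
    AntitoneOn (sortDescN v) (Finset.range Λ : Set ℕ) := by
  intro i hi j hj hij
  simp only [Finset.coe_range, Set.mem_Iio] at hi hj
  simp only [sortDescN, hi, hj, dif_pos]
  exact Tuple.monotone_sort v (Fin.rev_le_rev.mpr hij)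

theorem expec_sortDescN_le {p : Fin K → ℝ} (hp : ∀ k, 0 ≤ p k ∧ p k ≤ 1) (g : Fin K → Fin Λ)
    {m : ℝ} (hm : 0 ≤ m)
    (hdisp : ∑ c : Fin Λ, (sigma2C p g c + (muC p g c - m) ^ 2) ≤ m ^ 2) {i : ℕ} (hi : i < Λ) :
    expec p (fun ω => (sortDescN (load g ω) i : ℝ)) ≤ 2 * m := by
  have h : (expec p (fun ω => (sortDescN (load g ω) i : ℝ)) - m) ^ 2 ≤ m ^ 2 := by
    refine (sq_expec_sub_le hp _ m).trans (le_trans ?_ hdisp)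
    simp only [← expec_load_sub_sq]
    rw [← expec_sum]
    refine expec_mono hp fun ω => ?_
    rw [← sum_sortDescN (load g ω) (fun n => ((n : ℝ) - m) ^ 2)]
    exact Finset.single_le_sum (f := fun i => ((sortDescN (load g ω) i : ℝ) - m) ^ 2)
      (fun _ _ => sq_nonneg _) (Finset.mem_range.mpr hi)
  linarith [(abs_le.mp (abs_le_of_sq_le_sq h hm)).2]

theorem sum_range_choose_reflect (Λ t : ℕ) :
    ∑ i ∈ Finset.range Λ, (Λ - 1 - i).choose t = Λ.choose (t + 1) := by
  rw [Finset.sum_range_reflect (fun j => j.choose t)]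
  induction Λ with
  | zero => simp
  | succ n ih => rw [Finset.sum_range_succ, ih, Nat.choose_succ_succ, add_comm]

theorem sum_choose_ratio {t : ℕ} (ht : t ≤ Λ) :
    ∑ i ∈ Finset.range Λ, ((Λ - 1 - i).choose t : ℝ) / (Λ.choose t : ℝ) =
      ((Λ : ℝ) - t) / (1 + t) := by
  have hpos : (0 : ℝ) < Λ.choose t := by exact_mod_cast Nat.choose_pos ht
  have h := Nat.choose_succ_right_eq Λ t
  rw [← sum_range_choose_reflect] at h
  have h' := congrArg (Nat.cast : ℕ → ℝ) h
  push_cast [Nat.cast_sub ht] at h'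
  rw [← Finset.sum_div, div_eq_div_iff hpos.ne' (by positivity)]
  linarith

/-- The terms beyond `Λ - t` in the average delay vanish. -/
theorem avgDelay_eq_sum_range (p : Fin K → ℝ) (g : Fin K → Fin Λ) {t : ℕ} (ht : 1 ≤ t) :
    avgDelay p g t = ∑ i ∈ Finset.range Λ, expec p (fun ω => (sortDescN (load g ω) i : ℝ)) *
      (((Λ - 1 - i).choose t : ℝ) / (Λ.choose t : ℝ)) := by
  simp only [avgDelay, mul_div_assoc]
  refine Finset.sum_subset (Finset.range_mono (Nat.sub_le _ _)) fun i _ hi => ?_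
  rw [Finset.mem_range] at hi
  rw [Nat.choose_eq_zero_of_lt (by omega : Λ - 1 - i < t)]
  simp

/-- Chebyshev's sum inequality bounds every average delay from below. -/
theorem le_avgDelay {p : Fin K → ℝ} (hp : ∀ k, 0 ≤ p k ∧ p k ≤ 1) (hΛ : 0 < Λ)
    (g : Fin K → Fin Λ) {t : ℕ} (ht1 : 1 ≤ t) (ht : t ≤ Λ) :
    ((∑ k, p k) / (Λ : ℝ)) * (((Λ : ℝ) - t) / (1 + t)) ≤ avgDelay p g t := by
  have hΛ' : (0 : ℝ) < Λ := by exact_mod_cast hΛ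
  have hsum : ∑ i ∈ Finset.range Λ, expec p (fun ω => (sortDescN (load g ω) i : ℝ)) =
      ∑ k, p k := by
    rw [← expec_sum, ← sum_muC p g]
    simp only [← expec_load]
    rw [← expec_sum]
    congr 1
    funext ω
    exact sum_sortDescN (load g ω) (fun n => (n : ℝ))
  have hcheb : MonovaryOn (fun i => expec p (fun ω => (sortDescN (load g ω) i : ℝ)))
      (fun i => ((Λ - 1 - i).choose t : ℝ) / (Λ.choose t : ℝ)) (Finset.range Λ : Set ℕ) := by
    refine AntitoneOn.monovaryOn (fun i hi j hj hij => expec_mono hp fun ω => ?_)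
      (fun i _ j _ hij => ?_)
    · exact_mod_cast sortDescN_antitoneOn (load g ω) hi hj hij
    · have : (Λ - 1 - j).choose t ≤ (Λ - 1 - i).choose t := Nat.choose_le_choose t (by omega)
      gcongr
  have h := hcheb.sum_mul_sum_le_card_mul_sum
  rw [hsum, sum_choose_ratio ht, ← avgDelay_eq_sum_range p g ht1, Finset.card_range] at h
  rw [div_mul_eq_mul_div, div_le_iff₀ hΛ']
  linarith

end

/-- Corollary 1 (explicit form): if the load dispersion of `g` is at most `(K_p/Λ)²`,
then `g` is within a factor `2` of the optimal association. -/
theorem corollary1_order_optimal {K Λ t : ℕ} (hΛ : 2 ≤ Λ) (ht1 : 1 ≤ t) (ht2 : t ≤ Λ - 1)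
    (p : Fin K → ℝ) (hp : ∀ k, 0 ≤ p k ∧ p k ≤ 1) (g : Fin K → Fin Λ)
    (hdisp : ∑ c : Fin Λ, (sigma2C p g c + (muC p g c - (∑ k, p k) / (Λ : ℝ)) ^ 2) ≤
      ((∑ k, p k) / (Λ : ℝ)) ^ 2) :
    avgDelay p g t ≤ 2 * ((∑ k, p k) / (Λ : ℝ)) * ((Λ : ℝ) - t) / (1 + t) ∧
      ∀ g' : Fin K → Fin Λ, avgDelay p g t ≤ 2 * avgDelay p g' t := by
  have hm : 0 ≤ (∑ k, p k) / (Λ : ℝ) :=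
    div_nonneg (Finset.sum_nonneg fun k _ => (hp k).1) (Nat.cast_nonneg _)
  have hupper : avgDelay p g t ≤ 2 * ((∑ k, p k) / (Λ : ℝ)) * (((Λ : ℝ) - t) / (1 + t)) := by
    rw [avgDelay_eq_sum_range p g ht1, ← sum_choose_ratio (by omega : t ≤ Λ), Finset.mul_sum]
    exact Finset.sum_le_sum fun i hi => mul_le_mul_of_nonneg_right
      (expec_sortDescN_le hp g hm hdisp (Finset.mem_range.mp hi)) (by positivity)
  refine ⟨by rwa [mul_div_assoc], fun g' => ?_⟩
  linarith [le_avgDelay hp (by omega) g' ht1 (by omega : t ≤ Λ)]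

end
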